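/- Let N ≥ 1, J > 0, T > 0, write S = (ZMod N) × (ZMod N) for the periodic N×N grid, let I[φ] be the discrete Dirichlet energy, and let V_ε(φ) = −(ε/2)φ² + (ε/4)φ⁴. Then lim_{ε→∞} (∫_{ℝ^S} e^{−(J/T) I[φ]} ∏_{I∈S} e^{−V_ε(φ_I)} dφ) / (∫_ℝ e^{−V_ε(u)} du)^{N²} = 2^{−N²} Σ_{σ : S → {−1,+1}} e^{−(J/T) I[σ]}. In particular, in the strong-coupling limit ε → ∞ the equilibrium partition function of the lattice field theory reduces (up to normalization) to the partition function of the two-dimensional Ising model with coupling J. -/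

import Mathlib

open MeasureTheory Real Filter Topology

/-- The discrete Dirichlet energy of a field on the periodic `N × N` grid:
`I[φ] = (1/2) Σ_{i,j} [(φ_{i+1,j} − φ_{i,j})² + (φ_{i,j+1} − φ_{i,j})²]`,
with index arithmetic modulo `N`. -/
noncomputable def dirichletEnergy (N : ℕ) [NeZero N] (φ : ZMod N × ZMod N → ℝ) : ℝ :=
  (1 / 2) * ∑ p : ZMod N × ZMod N,
    ((φ (p.1 + 1, p.2) - φ p) ^ 2 + (φ (p.1, p.2 + 1) - φ p) ^ 2)

/-- The symmetric double-well potential `V_ε(φ) = −(ε/2)φ² + (ε/4)φ⁴`. -/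
noncomputable def doubleWell (ε φ : ℝ) : ℝ := -(ε / 2) * φ ^ 2 + (ε / 4) * φ ^ 4

/-- **Laplace's principle.** If `G ≥ 0` attains the value `0` and `h` is bounded and close to `c`
wherever `G` is small, then the averages of `h` against `exp (-ε G)` tend to `c`. -/
theorem tendsto_integral_mul_exp_neg_div {α : Type*} [TopologicalSpace α] [MeasurableSpace α]
    [BorelSpace α] {μ : Measure α} [μ.IsOpenPosMeasure] {G h : α → ℝ} {c C : ℝ} {x₀ : α}
    (hG : Continuous G) (hG0 : ∀ x, 0 ≤ G x) (hx₀ : G x₀ = 0)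
    (hint : Integrable (fun x => exp (-G x)) μ) (hh : Continuous h) (hC : ∀ x, |h x - c| ≤ C)
    (hc : ∀ η > 0, ∃ δ > 0, ∀ x, G x < δ → |h x - c| < η) :
    Tendsto (fun ε : ℝ => (∫ x, h x * exp (-(ε * G x)) ∂μ) / ∫ x, exp (-(ε * G x)) ∂μ)
      atTop (𝓝 c) := by
  have hC0 : 0 ≤ C := (abs_nonneg _).trans (hC x₀)
  have hWint : ∀ ε : ℝ, 1 ≤ ε → Integrable (fun x => exp (-(ε * G x))) μ := by
    intro ε hε
    refine hint.mono' (by fun_prop) (ae_of_all _ fun x => ?_)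
    rw [norm_of_nonneg (exp_pos _).le, exp_le_exp]
    nlinarith [hG0 x]
  have hdint : ∀ ε : ℝ, 1 ≤ ε → Integrable (fun x => (h x - c) * exp (-(ε * G x))) μ := by
    intro ε hε
    exact (hWint ε hε).bdd_mul (c := C) (by fun_prop) (ae_of_all _ hC)
  set M := ∫ x, exp (-G x) ∂μ
  rw [Metric.tendsto_nhds]
  intro η hη
  obtain ⟨δ, hδ, hδh⟩ := hc (η / 2) (half_pos hη)
  set A := {x | G x < δ / 2} with hA
  have hAo : IsOpen A := isOpen_lt hG continuous_const
  set K := ∫ x in A, exp (-G x) ∂μ with hK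
  have hKpos : 0 < K := by
    rw [hK, setIntegral_pos_iff_support_of_nonneg_ae (ae_of_all _ fun x => (exp_pos _).le)
      hint.integrableOn]
    have : Function.support (fun x => exp (-G x)) = Set.univ := by
      ext x; simp [(exp_pos _).ne']
    rw [this, Set.univ_inter]
    exact hAo.measure_pos μ ⟨x₀, by simp [hA, hx₀, hδ]⟩
  have hlim : Tendsto (fun ε : ℝ => C * M / K * exp (-((ε - 1) * (δ / 2)))) atTop (𝓝 0) := by
    have h1 : Tendsto (fun ε : ℝ => (ε - 1) * (δ / 2)) atTop atTop :=
      (tendsto_atTop_add_const_right _ (-1) tendsto_id).atTop_mul_const (half_pos hδ)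
    simpa using (tendsto_exp_neg_atTop_nhds_zero.comp h1).const_mul (C * M / K)
  filter_upwards [eventually_ge_atTop 1, hlim.eventually_lt_const (half_pos hη)] with ε hε hsmall
  set Z := ∫ x, exp (-(ε * G x)) ∂μ with hZ
  have hlow : exp (-((ε - 1) * (δ / 2))) * K ≤ Z := by
    calc exp (-((ε - 1) * (δ / 2))) * K
        = ∫ x in A, exp (-((ε - 1) * (δ / 2))) * exp (-G x) ∂μ := by
          rw [hK, integral_const_mul]
      _ ≤ ∫ x in A, exp (-(ε * G x)) ∂μ := by
          refine setIntegral_mono_on (hint.integrableOn.const_mul _) (hWint ε hε).integrableOn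
            hAo.measurableSet fun x hx => ?_
          rw [← exp_add, exp_le_exp]
          have hx' : G x < δ / 2 := hx
          nlinarith
      _ ≤ Z := setIntegral_le_integral (hWint ε hε) (ae_of_all _ fun x => (exp_pos _).le)
  have hZpos : 0 < Z := (by positivity : 0 < exp (-((ε - 1) * (δ / 2))) * K).trans_le hlow
  have hup : |∫ x, (h x - c) * exp (-(ε * G x)) ∂μ|
      ≤ η / 2 * Z + C * exp (-((ε - 1) * δ)) * M := by
    calc |∫ x, (h x - c) * exp (-(ε * G x)) ∂μ|
        ≤ ∫ x, |(h x - c) * exp (-(ε * G x))| ∂μ := abs_integral_le_integral_abs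
      _ ≤ ∫ x, (η / 2 * exp (-(ε * G x)) + C * exp (-((ε - 1) * δ)) * exp (-G x)) ∂μ := by
          refine integral_mono (hdint ε hε).abs
            (((hWint ε hε).const_mul _).add (hint.const_mul _)) fun x => ?_
          simp only [abs_mul, abs_of_pos (exp_pos _)]
          by_cases hx : G x < δ
          · have := mul_le_mul_of_nonneg_right (hδh x hx).le (exp_pos (-(ε * G x))).le
            have : 0 ≤ C * exp (-((ε - 1) * δ)) * exp (-G x) := by positivity
            linarith
          · have h1 : exp (-(ε * G x)) ≤ exp (-((ε - 1) * δ)) * exp (-G x) := by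
              rw [← exp_add, exp_le_exp]
              nlinarith
            have h2 := mul_le_mul (hC x) h1 (exp_pos _).le hC0
            have : 0 ≤ η / 2 * exp (-(ε * G x)) := by positivity
            linarith
      _ = η / 2 * Z + C * exp (-((ε - 1) * δ)) * M := by
          rw [integral_add ((hWint ε hε).const_mul _) (hint.const_mul _), integral_const_mul,
            integral_const_mul]
  have hhint : Integrable (fun x => h x * exp (-(ε * G x))) μ := by
    refine ((hdint ε hε).add ((hWint ε hε).const_mul c)).congr (ae_of_all _ fun x => ?_)
    simp only [Pi.add_apply]; ring
  have hsub : ∫ x, (h x - c) * exp (-(ε * G x)) ∂μ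
      = (∫ x, h x * exp (-(ε * G x)) ∂μ) - c * Z := by
    rw [hZ, ← integral_const_mul, ← integral_sub hhint ((hWint ε hε).const_mul c)]
    simp only [sub_mul]
  rw [hsub] at hup
  have hsq : exp (-((ε - 1) * δ)) = exp (-((ε - 1) * (δ / 2))) * exp (-((ε - 1) * (δ / 2))) := by
    rw [← exp_add]; congr 1; ring
  have htail : C * exp (-((ε - 1) * δ)) * M < η / 2 * Z := by
    calc C * exp (-((ε - 1) * δ)) * M
        = C * M / K * exp (-((ε - 1) * (δ / 2))) * (exp (-((ε - 1) * (δ / 2))) * K) := by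
          rw [hsq]; field_simp
      _ < η / 2 * (exp (-((ε - 1) * (δ / 2))) * K) :=
          mul_lt_mul_of_pos_right hsmall (by positivity)
      _ ≤ η / 2 * Z := by gcongr
  rw [Real.dist_eq, div_sub' hZpos.ne', abs_div, abs_of_pos hZpos, div_lt_iff₀ hZpos, mul_comm Z c]
  linarith

/-- The well `(u² - 1)² / 4`, i.e. `doubleWell 1` shifted so that its minimum is `0`. -/
noncomputable def quarticWell (u : ℝ) : ℝ := (u ^ 2 - 1) ^ 2 / 4

theorem quarticWell_nonneg (u : ℝ) : 0 ≤ quarticWell u := by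
  unfold quarticWell; positivity

theorem continuous_quarticWell : Continuous quarticWell := by
  unfold quarticWell; fun_prop

theorem neg_doubleWell_eq (ε u : ℝ) : -doubleWell ε u = ε / 4 + -(ε * quarticWell u) := by
  unfold doubleWell quarticWell; ring

theorem sq_abs_sub_one_le_quarticWell (u : ℝ) : (|u| - 1) ^ 2 ≤ 4 * quarticWell u := by
  have h := abs_nonneg u
  rw [quarticWell, ← sq_abs u]
  have : (|u| ^ 2 - 1) ^ 2 = (|u| - 1) ^ 2 * (|u| + 1) ^ 2 := by ring
  nlinarith [mul_nonneg (sq_nonneg (|u| - 1)) (by nlinarith : 0 ≤ (|u| + 1) ^ 2 - 1)]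

theorem integrable_exp_neg_quarticWell : Integrable fun u : ℝ => exp (-quarticWell u) := by
  refine ((integrable_exp_neg_mul_sq one_pos).const_mul (exp 2)).mono'
    (by have := continuous_quarticWell; fun_prop) (ae_of_all _ fun u => ?_)
  rw [norm_of_nonneg (exp_pos _).le, ← exp_add, exp_le_exp, quarticWell]
  nlinarith [sq_nonneg (u ^ 2 - 3)]

section SignFlip

variable {S : Type*}

/-- Multiply each coordinate of `φ` by the corresponding sign. -/
def signFlip (σ : S → ℤˣ) (φ : S → ℝ) : S → ℝ := fun i => ((σ i : ℤ) : ℝ) * φ i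

theorem signFlip_mul (σ τ : S → ℤˣ) (φ : S → ℝ) :
    signFlip (σ * τ) φ = signFlip σ (signFlip τ φ) := by
  ext i; simp [signFlip, mul_assoc]

theorem continuous_signFlip (σ : S → ℤˣ) : Continuous (signFlip σ) := by
  unfold signFlip; fun_prop

theorem exists_signFlip_eq_abs (φ : S → ℝ) : ∃ σ, signFlip σ φ = fun i => |φ i| := by
  refine ⟨fun i => if 0 ≤ φ i then 1 else -1, funext fun i => ?_⟩
  by_cases h : 0 ≤ φ i
  · simp [signFlip, h, abs_of_nonneg]
  · simp [signFlip, h, abs_of_neg (not_le.1 h)]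

theorem measurePreserving_signFlip [Fintype S] (σ : S → ℤˣ) :
    MeasurePreserving (signFlip σ) := by
  refine volume_preserving_pi (f := fun i x => ((σ i : ℤ) : ℝ) * x) fun i => ?_
  rcases Int.units_eq_one_or (σ i) with h | h
  · convert MeasurePreserving.id (volume : Measure ℝ) using 1
    ext x; simp [h]
  · convert Measure.measurePreserving_neg (volume : Measure ℝ) using 1
    ext x; simp [h]

theorem quarticWell_signFlip (σ : S → ℤˣ) (φ : S → ℝ) (i : S) :
    quarticWell (signFlip σ φ i) = quarticWell (φ i) := by
  rcases Int.units_eq_one_or (σ i) with h | h <;> simp [signFlip, quarticWell, h]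

variable [Fintype S] [DecidableEq S]

/-- The average of `F` over all coordinatewise sign changes. -/
noncomputable def signAverage (F : (S → ℝ) → ℝ) (φ : S → ℝ) : ℝ :=
  (2 ^ Fintype.card S)⁻¹ * ∑ σ : S → ℤˣ, F (signFlip σ φ)

theorem signAverage_signFlip (F : (S → ℝ) → ℝ) (τ : S → ℤˣ) (φ : S → ℝ) :
    signAverage F (signFlip τ φ) = signAverage F φ := by
  unfold signAverage
  simp_rw [← signFlip_mul]
  exact congrArg _ (Equiv.sum_comp (Equiv.mulRight τ) fun σ => F (signFlip σ φ))

theorem signAverage_abs (F : (S → ℝ) → ℝ) (φ : S → ℝ) :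
    signAverage F (fun i => |φ i|) = signAverage F φ := by
  obtain ⟨σ, hσ⟩ := exists_signFlip_eq_abs φ
  rw [← hσ, signAverage_signFlip]

theorem continuous_signAverage {F : (S → ℝ) → ℝ} (hF : Continuous F) :
    Continuous (signAverage F) :=
  continuous_const.mul <| continuous_finsetSum _ fun σ _ => hF.comp (continuous_signFlip σ)

theorem abs_signAverage_le {F : (S → ℝ) → ℝ} {C : ℝ} (hF : ∀ φ, |F φ| ≤ C) (φ : S → ℝ) :
    |signAverage F φ| ≤ C := by
  rw [signAverage, abs_mul, abs_of_pos (by positivity), inv_mul_le_iff₀ (by positivity)]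
  refine (Finset.abs_sum_le_sum_abs _ _).trans ((Finset.sum_le_sum fun σ _ => hF _).trans ?_)
  simp

theorem integral_signAverage_mul {F W : (S → ℝ) → ℝ} (hFW : Integrable fun φ => F φ * W φ)
    (hW : ∀ σ φ, W (signFlip σ φ) = W φ) :
    ∫ φ, signAverage F φ * W φ = ∫ φ, F φ * W φ := by
  have hmp (σ : S → ℤˣ) := measurePreserving_signFlip σ
  have heq (σ : S → ℤˣ) : (fun φ => F (signFlip σ φ) * W φ)
      = (fun φ => F φ * W φ) ∘ signFlip σ := by
    ext φ; simp [hW]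
  have hflip (σ : S → ℤˣ) : ∫ φ, F (signFlip σ φ) * W φ = ∫ φ, F φ * W φ := by
    rw [heq]
    have h := integral_map (hmp σ).measurable.aemeasurable
      (f := fun φ => F φ * W φ) (by rw [(hmp σ).map_eq]; exact hFW.aestronglyMeasurable)
    rw [(hmp σ).map_eq] at h
    exact h.symm
  simp_rw [signAverage, mul_assoc, Finset.sum_mul]
  rw [integral_const_mul, integral_finsetSum]
  · simp [hflip]
  · intro σ _
    rw [heq]
    exact (hmp σ).integrable_comp_of_integrable hFW

/-- Strong coupling in a product of quartic wells averages a bounded continuous observable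
over all sign configurations. -/
theorem tendsto_integral_quarticWell_div {F : (S → ℝ) → ℝ} {C : ℝ} (hF : Continuous F)
    (hC : ∀ φ, |F φ| ≤ C) :
    Tendsto (fun ε : ℝ => (∫ φ : S → ℝ, F φ * exp (-(ε * ∑ i, quarticWell (φ i)))) /
        ∫ φ : S → ℝ, exp (-(ε * ∑ i, quarticWell (φ i))))
      atTop (𝓝 (signAverage F 1)) := by
  have hcont : Continuous fun φ : S → ℝ => ∑ i, quarticWell (φ i) :=
    continuous_finsetSum _ fun i _ => continuous_quarticWell.comp (continuous_apply i)
  have hnonneg : ∀ φ : S → ℝ, 0 ≤ ∑ i, quarticWell (φ i) :=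
    fun φ => Finset.sum_nonneg fun i _ => quarticWell_nonneg _
  have hint : Integrable fun φ : S → ℝ => exp (-∑ i, quarticWell (φ i)) := by
    simp_rw [← Finset.sum_neg_distrib, exp_sum]
    exact Integrable.fintype_prod fun _ => integrable_exp_neg_quarticWell
  have key := tendsto_integral_mul_exp_neg_div (μ := volume) (h := signAverage F)
    (c := signAverage F 1) (C := C + C) (x₀ := 1) hcont hnonneg (by simp [quarticWell]) hint
    (continuous_signAverage hF)
    (fun φ => (abs_sub _ _).trans
      (add_le_add (abs_signAverage_le hC φ) (abs_signAverage_le hC 1))) ?_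
  · refine key.congr' ?_
    filter_upwards [eventually_ge_atTop 1] with ε hε
    rw [integral_signAverage_mul]
    · have hWint : Integrable fun φ : S → ℝ => exp (-(ε * ∑ i, quarticWell (φ i))) := by
        refine hint.mono' (hcont.const_mul ε).neg.rexp.aestronglyMeasurable
          (ae_of_all _ fun φ => ?_)
        rw [norm_of_nonneg (exp_pos _).le, exp_le_exp]
        nlinarith [hnonneg φ]
      exact hWint.bdd_mul (c := C) (by fun_prop) (ae_of_all _ hC)
    · simp [quarticWell_signFlip]
  · intro η hη
    obtain ⟨r, hr, hrF⟩ := Metric.continuous_iff.1 (continuous_signAverage hF) 1 η hη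
    refine ⟨r ^ 2 / 4, by positivity, fun φ hφ => ?_⟩
    rw [← signAverage_abs]
    refine hrF _ ((dist_pi_lt_iff hr).2 fun i => ?_)
    have h1 : quarticWell (φ i) ≤ ∑ j, quarticWell (φ j) :=
      Finset.single_le_sum (fun j _ => quarticWell_nonneg (φ j)) (Finset.mem_univ i)
    refine abs_lt_of_sq_lt_sq ?_ hr.le
    have := sq_abs_sub_one_le_quarticWell (φ i)
    simp only [Pi.one_apply]
    linarith

/-- Signs as real numbers: the units of `ℤ` correspond to the two-element set `{-1, 1}`. -/
noncomputable def unitsEquivSigns : ℤˣ ≃ ({-1, 1} : Finset ℝ) :=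
  Equiv.ofBijective (fun u => ⟨((u : ℤ) : ℝ), by
    rcases Int.units_eq_one_or u with h | h <;> simp [h]⟩) <| by
    constructor
    · intro u v h
      simpa [Units.ext_iff] using h
    · rintro ⟨x, hx⟩
      rcases Finset.mem_insert.1 hx with rfl | hx
      · exact ⟨-1, by simp⟩
      · exact ⟨1, by simp [Finset.mem_singleton.1 hx]⟩

theorem signAverage_one (F : (S → ℝ) → ℝ) :
    signAverage F 1 = (2 ^ Fintype.card S)⁻¹ *
      ∑ s : S → ({-1, 1} : Finset ℝ), F fun i => (s i : ℝ) := by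
  rw [signAverage, ← Equiv.sum_comp (Equiv.piCongrRight fun _ : S => unitsEquivSigns)]
  congr 1
  refine Finset.sum_congr rfl fun σ _ => congrArg F (funext fun i => ?_)
  simp [signFlip]
  rfl

end SignFlip

theorem dirichletEnergy_nonneg (N : ℕ) [NeZero N] (φ : ZMod N × ZMod N → ℝ) :
    0 ≤ dirichletEnergy N φ := by
  unfold dirichletEnergy; positivity

theorem continuous_dirichletEnergy (N : ℕ) [NeZero N] : Continuous (dirichletEnergy N) := by
  unfold dirichletEnergy; fun_prop

/-- **Strong-coupling reduction to the 2D Ising model.** For `N ≥ 1`, `J > 0`, `T > 0`,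
in the limit `ε → ∞` the normalized equilibrium partition function of the lattice field
theory with Dirichlet energy `I[φ]` and on-site double-well potential `V_ε` reduces to the
partition function of the two-dimensional Ising model with coupling `J`:
`lim_{ε→∞} (∫ e^{−(J/T)I[φ]} ∏_I e^{−V_ε(φ_I)} dφ) / (∫ e^{−V_ε(u)} du)^{N²}
  = 2^{−N²} Σ_{σ : S → {−1,+1}} e^{−(J/T)I[σ]}`. -/
theorem strong_coupling_ising_limit (N : ℕ) [NeZero N] (J T : ℝ) (hJ : 0 < J) (hT : 0 < T) :
    Tendsto
      (fun ε : ℝ =>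
        (∫ φ : ZMod N × ZMod N → ℝ,
            Real.exp (-(J / T) * dirichletEnergy N φ) *
              ∏ I : ZMod N × ZMod N, Real.exp (-(doubleWell ε (φ I)))) /
          (∫ u : ℝ, Real.exp (-(doubleWell ε u))) ^ (N ^ 2))
      atTop
      (𝓝 ((2 : ℝ) ^ (-(N ^ 2 : ℤ)) *
        ∑ s : ZMod N × ZMod N → ({-1, 1} : Finset ℝ),
          Real.exp (-(J / T) * dirichletEnergy N fun I => (s I : ℝ)))) := by
  have hcard : Fintype.card (ZMod N × ZMod N) = N ^ 2 := by
    simp [ZMod.card, sq]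
  have hF : Continuous fun φ => exp (-(J / T) * dirichletEnergy N φ) := by
    have := continuous_dirichletEnergy N
    fun_prop
  have hC : ∀ φ, |exp (-(J / T) * dirichletEnergy N φ)| ≤ 1 := by
    intro φ
    rw [abs_of_pos (exp_pos _), exp_le_one_iff, neg_mul, neg_nonpos]
    have := dirichletEnergy_nonneg N φ
    positivity
  have key := tendsto_integral_quarticWell_div hF hC
  rw [signAverage_one, hcard] at key
  have hpow : (2 : ℝ) ^ (-(N ^ 2 : ℤ)) = (2 ^ N ^ 2)⁻¹ := by
    rw [zpow_neg]; norm_cast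
  rw [hpow]
  refine key.congr fun ε => ?_
  have hprod (φ : ZMod N × ZMod N → ℝ) : ∏ I, exp (-(doubleWell ε (φ I)))
      = exp (ε / 4) ^ N ^ 2 * exp (-(ε * ∑ I, quarticWell (φ I))) := by
    simp_rw [neg_doubleWell_eq, exp_add, Finset.prod_mul_distrib]
    rw [Finset.prod_const, Finset.card_univ, hcard, ← exp_sum, Finset.sum_neg_distrib,
      Finset.mul_sum]
  rw [← hcard, ← integral_fintype_prod_volume_eq_pow (ι := ZMod N × ZMod N)
    (fun u => exp (-(doubleWell ε u)))]
  simp_rw [hprod, mul_left_comm (exp (-(J / T) * _)), integral_const_mul]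
  rw [mul_div_mul_left _ _ (by positivity)]
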